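/- For the radial PML map Φ(x) = ζ(r)x with J = (ζ'/r)xxᵀ + ζI, and a C¹ transverse field Ψ with transformed field Ψ̃ = J⁻ᵀ(Ψ∘Φ⁻¹), the scalar curl transforms as: (curl̃ Ψ̃) ∘ Φ = (1/(η')²)(1 + ζ'r²/η)·curl Ψ, where curl F = ∂₀F₁ − ∂₁F₀, η(r) = rζ(r). -/

import Mathlib

open Matrix

/-- Chain rule for a radial function: `y ↦ h ‖y‖` has gradient `h' ‖x‖ x / ‖x‖`. -/
theorem exists_hasFDerivAt_comp_norm (x : EuclideanSpace ℝ (Fin 2)) (hx : x ≠ 0)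
    (h : ℝ → ℂ) (h' : ℂ) (hd : HasDerivAt h h' ‖x‖) :
    ∃ L : EuclideanSpace ℝ (Fin 2) →L[ℝ] ℂ, HasFDerivAt (fun y => h ‖y‖) L x ∧
      ∀ k, L (EuclideanSpace.single k 1) = (x k : ℂ) / (‖x‖ : ℂ) * h' := by
  have hn : ‖x‖ ≠ 0 := norm_ne_zero_iff.mpr hx
  have h1 := (hasStrictFDerivAt_norm_sq x).hasFDerivAt.sqrt (pow_ne_zero 2 hn)
  simp only [Real.sqrt_sq (norm_nonneg _)] at h1
  refine ⟨_, hd.hasFDerivAt.comp x h1, fun k => ?_⟩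
  have hn' : (‖x‖ : ℂ) ≠ 0 := by exact_mod_cast hn
  simp [EuclideanSpace.inner_single_right]
  field_simp

/-- The coordinate functions, viewed as complex valued, have the dual basis as derivative. -/
theorem exists_hasFDerivAt_coord (x : EuclideanSpace ℝ (Fin 2)) (i : Fin 2) :
    ∃ L : EuclideanSpace ℝ (Fin 2) →L[ℝ] ℂ, HasFDerivAt (fun y => ((y i : ℝ) : ℂ)) L x ∧
      ∀ k, L (EuclideanSpace.single k 1) = if i = k then 1 else 0 := by
  refine ⟨Complex.ofRealCLM.comp (EuclideanSpace.proj i),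
    (Complex.ofRealCLM.comp (EuclideanSpace.proj i)).hasFDerivAt, fun k => ?_⟩
  by_cases hik : i = k <;> simp [hik]

/-- For the radial PML map `Φ(x) = ζ(r)x` with Jacobian
`J = (ζ'/r)xxᵀ + ζI`, and a C¹ transverse field `Ψ` with transformed field
`Ψ̃ = J⁻ᵀ(Ψ∘Φ⁻¹)`, the scalar curl transforms as
`(curl̃ Ψ̃) ∘ Φ = (1/(η')²)(1 + ζ'r²/η)·curl Ψ`, where `η(r) = rζ(r)`.
Here the curl in the transformed coordinates is expressed via the chain rule:
`(∂̃_j F̃) ∘ Φ = Σ_k (J⁻¹)_{kj} ∂_k (F̃ ∘ Φ)`, and `G = Ψ̃ ∘ Φ = J⁻ᵀ Ψ`. -/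
theorem stmt_18 (ζ ζ' ζ'' : ℝ → ℂ)
    (hζd : ∀ s ∈ Set.Ioi (0:ℝ), HasDerivAt ζ (ζ' s) s)
    (hζd' : ∀ s ∈ Set.Ioi (0:ℝ), HasDerivAt ζ' (ζ'' s) s)
    (hnz : ∀ s ∈ Set.Ioi (0:ℝ), ζ s * (ζ s + (s : ℂ) * ζ' s) ≠ 0)
    (Ψ : EuclideanSpace ℝ (Fin 2) → Fin 2 → ℂ)
    (hΨ : ∀ i, ContDiff ℝ 1 (fun y => Ψ y i))
    (x : EuclideanSpace ℝ (Fin 2)) (r : ℝ) (hr : r = ‖x‖) (hrpos : 0 < r)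
    (Jf : EuclideanSpace ℝ (Fin 2) → Matrix (Fin 2) (Fin 2) ℂ)
    (hJf : ∀ y i j, Jf y i j = (ζ' ‖y‖ / (‖y‖ : ℂ)) * (y i : ℂ) * (y j : ℂ)
      + ζ ‖y‖ * (if i = j then 1 else 0))
    (G : EuclideanSpace ℝ (Fin 2) → Fin 2 → ℂ)
    (hG : ∀ y, G y = ((Jf y)⁻¹)ᵀ.mulVec (Ψ y)) :
    (∑ k, (Jf x)⁻¹ k 0 * fderiv ℝ (fun y => G y 1) x (EuclideanSpace.single k 1))
      - (∑ k, (Jf x)⁻¹ k 1 * fderiv ℝ (fun y => G y 0) x (EuclideanSpace.single k 1))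
      = (1 / (ζ r + (r : ℂ) * ζ' r) ^ 2) * (1 + ζ' r * (r : ℂ) ^ 2 / ((r : ℂ) * ζ r)) *
        (fderiv ℝ (fun y => Ψ y 1) x (EuclideanSpace.single 0 1)
          - fderiv ℝ (fun y => Ψ y 0) x (EuclideanSpace.single 1 1)) := by
  have hx : x ≠ 0 := norm_pos_iff.mp (hr ▸ hrpos)
  subst hr
  have hrc : (‖x‖ : ℂ) ≠ 0 := by exact_mod_cast hrpos.ne'
  have hdet : ∀ y, y ≠ 0 → (Jf y).det = ζ ‖y‖ * (ζ ‖y‖ + (‖y‖ : ℂ) * ζ' ‖y‖) := by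
    intro y hy
    have hyc : (‖y‖ : ℂ) ≠ 0 := by exact_mod_cast norm_ne_zero_iff.mpr hy
    have hsq : (‖y‖ : ℂ) ^ 2 = (y 0 : ℂ) ^ 2 + (y 1 : ℂ) ^ 2 := by
      have := EuclideanSpace.real_norm_sq_eq y
      rw [Fin.sum_univ_two] at this
      exact_mod_cast this
    rw [Matrix.det_fin_two]
    simp only [hJf]
    simp
    field_simp
    linear_combination (-ζ' ‖y‖ * (‖y‖ : ℂ) * ζ ‖y‖) * hsq
  have hdet0 : ∀ y, y ≠ 0 → (Jf y).det ≠ 0 := fun y hy => by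
    rw [hdet y hy]
    exact hnz _ (norm_pos_iff.mpr hy)
  have hinv : ∀ y, (Jf y)⁻¹ = ((Jf y).det)⁻¹ • !![Jf y 1 1, -Jf y 0 1; -Jf y 1 0, Jf y 0 0] := by
    intro y
    rw [Matrix.inv_def, Ring.inverse_eq_inv', Matrix.adjugate_fin_two]
  have hG0 : ∀ y, G y 0 = ((Jf y).det)⁻¹ * (Jf y 1 1 * Ψ y 0 - Jf y 1 0 * Ψ y 1) := by
    intro y
    rw [hG, hinv]
    simp [Matrix.mulVec, dotProduct, Fin.sum_univ_two]
    ring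
  have hG1 : ∀ y, G y 1 = ((Jf y).det)⁻¹ * (Jf y 0 0 * Ψ y 1 - Jf y 0 1 * Ψ y 0) := by
    intro y
    rw [hG, hinv]
    simp [Matrix.mulVec, dotProduct, Fin.sum_univ_two]
    ring
  obtain ⟨A, hA, hAk⟩ := exists_hasFDerivAt_comp_norm x hx (fun s => ζ' s / (s : ℂ)) _
    ((hζd' _ hrpos).div (Complex.ofRealCLM.hasDerivAt (x := ‖x‖)) hrc)
  obtain ⟨B, hB, hBk⟩ := exists_hasFDerivAt_comp_norm x hx ζ _ (hζd _ hrpos)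
  obtain ⟨X0, hX0, hX0k⟩ := exists_hasFDerivAt_coord x 0
  obtain ⟨X1, hX1, hX1k⟩ := exists_hasFDerivAt_coord x 1
  have hJ00 : HasFDerivAt (fun y => Jf y 0 0) _ x :=
    (((hA.mul hX0).mul hX0).add hB).congr_of_eventuallyEq
      (Filter.Eventually.of_forall fun y => by simp [hJf])
  have hJ01 : HasFDerivAt (fun y => Jf y 0 1) _ x :=
    ((hA.mul hX0).mul hX1).congr_of_eventuallyEq
      (Filter.Eventually.of_forall fun y => by simp [hJf])
  have hJ10 : HasFDerivAt (fun y => Jf y 1 0) _ x :=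
    ((hA.mul hX1).mul hX0).congr_of_eventuallyEq
      (Filter.Eventually.of_forall fun y => by simp [hJf])
  have hJ11 : HasFDerivAt (fun y => Jf y 1 1) _ x :=
    (((hA.mul hX1).mul hX1).add hB).congr_of_eventuallyEq
      (Filter.Eventually.of_forall fun y => by simp [hJf])
  have hΨd : ∀ i, DifferentiableAt ℝ (fun y => Ψ y i) x := fun i =>
    (hΨ i).differentiable (by simp) x
  have hdetd : DifferentiableAt ℝ (fun y => ((Jf y).det)⁻¹) x := by
    refine DifferentiableAt.inv ?_ (hdet0 x hx)
    simp only [Matrix.det_fin_two]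
    exact (hJ00.differentiableAt.mul hJ11.differentiableAt).sub
      (hJ01.differentiableAt.mul hJ10.differentiableAt)
  have hGd0 : DifferentiableAt ℝ (fun y => G y 0) x := by
    simp only [hG0]
    exact hdetd.mul ((hJ11.differentiableAt.mul (hΨd 0)).sub (hJ10.differentiableAt.mul (hΨd 1)))
  have hGd1 : DifferentiableAt ℝ (fun y => G y 1) x := by
    simp only [hG1]
    exact hdetd.mul ((hJ00.differentiableAt.mul (hΨd 1)).sub (hJ01.differentiableAt.mul (hΨd 0)))
  have hne : ∀ᶠ y in nhds x, y ≠ 0 := isOpen_ne.mem_nhds hx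
  have hΨ0 : HasFDerivAt (fun y => Ψ y 0) _ x :=
    ((hJ00.mul hGd0.hasFDerivAt).add (hJ10.mul hGd1.hasFDerivAt)).congr_of_eventuallyEq (by
      filter_upwards [hne] with y hy
      have h := hdet0 y hy
      simp only [Pi.add_apply, Pi.mul_apply, hG0, hG1]
      field_simp
      rw [Matrix.det_fin_two]
      ring)
  have hΨ1 : HasFDerivAt (fun y => Ψ y 1) _ x :=
    ((hJ01.mul hGd0.hasFDerivAt).add (hJ11.mul hGd1.hasFDerivAt)).congr_of_eventuallyEq (by
      filter_upwards [hne] with y hy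
      have h := hdet0 y hy
      simp only [Pi.add_apply, Pi.mul_apply, hG0, hG1]
      field_simp
      rw [Matrix.det_fin_two]
      ring)
  have hz := left_ne_zero_of_mul (hnz _ hrpos)
  have he := right_ne_zero_of_mul (hnz _ hrpos)
  have hfac : (1 / (ζ ‖x‖ + (‖x‖ : ℂ) * ζ' ‖x‖) ^ 2) *
      (1 + ζ' ‖x‖ * (‖x‖ : ℂ) ^ 2 / ((‖x‖ : ℂ) * ζ ‖x‖)) = ((Jf x).det)⁻¹ := by
    rw [hdet x hx]
    field_simp
  rw [hfac, hΨ0.fderiv, hΨ1.fderiv, hinv x]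
  generalize ((Jf x).det)⁻¹ = d
  simp [Fin.sum_univ_two, hAk, hBk, hX0k, hX1k]
  ring
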